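/- Fourier coefficients of the periodized Moyal product (Appendix B of the paper): Let N ≥ 1 be an integer, ℏ := 1/(2πN), and let F₁, F₂ be Schwartz functions on R^{2d}. Then for every n ∈ Z^{2d}, ∫_{[0,1]^{2d}} e^{2iπ⟨ρ, Jn⟩} · T₀( conj(F₁) ♯ F₂ )(ρ) dρ = ∫_{R^{2d}} e^{(iπ/N)⟨n,ρ⟩} · F̂₁*(ρ − Jn) · F̂₂(−ρ) dρ, where F̂₁* denotes the Fourier transform of the complex conjugate conj(F₁) of F₁. -/

import Mathlib

open MeasureTheory Matrix
open scoped ComplexConjugate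

noncomputable section

/-- The standard symplectic matrix `J = (0, -I; I, 0)` on `ℝ^{2d}`. -/
def Jmat (d : ℕ) : Matrix (Fin d ⊕ Fin d) (Fin d ⊕ Fin d) ℝ :=
  Matrix.fromBlocks 0 (-1) 1 0

/-- Euclidean inner product on `ℝ^{2d}`. -/
def ip {d : ℕ} (v w : (Fin d ⊕ Fin d) → ℝ) : ℝ := ∑ i, v i * w i

/-- The Moyal product
`(F₁ ♯ F₂)(w) = (πℏ)^{-2d} ∬ F₁(w+w₁) F₂(w+w₂) e^{-(2i/ℏ)⟨w₁, Jw₂⟩} dw₁ dw₂`. -/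
def moyal (d : ℕ) (ℏ : ℝ) (F₁ F₂ : ((Fin d ⊕ Fin d) → ℝ) → ℂ)
    (w : (Fin d ⊕ Fin d) → ℝ) : ℂ :=
  (((Real.pi * ℏ) ^ (2 * d))⁻¹ : ℝ) *
    ∫ w₁ : (Fin d ⊕ Fin d) → ℝ, ∫ w₂ : (Fin d ⊕ Fin d) → ℝ,
      F₁ (w + w₁) * F₂ (w + w₂) *
        Complex.exp (-(2 * Complex.I / ℏ) * (ip w₁ ((Jmat d).mulVec w₂) : ℝ))

/-- `ℤ^{2d}`-periodization `T₀(F)(ρ′) = ∑_{r ∈ ℤ^{2d}} F(ρ′ + r)`. -/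
def T0 {d : ℕ} (F : ((Fin d ⊕ Fin d) → ℝ) → ℂ) (ρ' : (Fin d ⊕ Fin d) → ℝ) : ℂ :=
  ∑' r : (Fin d ⊕ Fin d) → ℤ, F (ρ' + fun i => (r i : ℝ))

/-- Fourier transform `F̂(ρ) = ∫ F(w) e^{-2iπ⟨ρ,w⟩} dw` on `ℝ^{2d}`. -/
def FT {d : ℕ} (F : ((Fin d ⊕ Fin d) → ℝ) → ℂ) (ρ : (Fin d ⊕ Fin d) → ℝ) : ℂ :=
  ∫ w : (Fin d ⊕ Fin d) → ℝ, F w * Complex.exp (-(2 * Real.pi * Complex.I) * (ip ρ w : ℝ))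

/-- The integral over the unit cube of the periodization of an integrable function is its integral
over the whole space. -/
theorem setIntegral_Icc_T0 {d : ℕ} {f : ((Fin d ⊕ Fin d) → ℝ) → ℂ} (hf : Integrable f) :
    ∫ ρ in Set.Icc (0 : (Fin d ⊕ Fin d) → ℝ) 1, T0 f ρ = ∫ w, f w := by
  let b := Pi.basisFun ℝ (Fin d ⊕ Fin d)
  let e := (b.restrictScalars ℤ).equivFun
  have he (g : Submodule.span ℤ (Set.range b)) (x : (Fin d ⊕ Fin d) → ℝ) :
      (x + fun i => ((e g i : ℤ) : ℝ)) = g +ᵥ x := by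
    ext i
    have h := b.restrictScalars_repr_apply ℤ g i
    simp only [b, Pi.basisFun_repr] at h
    simp [e, Submodule.vadd_def, ← h, b, add_comm]
  have hdom : IsAddFundamentalDomain (Submodule.span ℤ (Set.range b))
      (ZSpan.fundamentalDomain b) (volume : Measure ((Fin d ⊕ Fin d) → ℝ)) :=
    ZSpan.isAddFundamentalDomain b volume
  have hinv : VAddInvariantMeasure (Submodule.span ℤ (Set.range b))
      ((Fin d ⊕ Fin d) → ℝ) volume :=
    inferInstanceAs
      (VAddInvariantMeasure (Submodule.span ℤ (Set.range b)).toAddSubgroup _ volume)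
  have hset : (Set.Icc (0 : (Fin d ⊕ Fin d) → ℝ) 1) =ᵐ[volume] ZSpan.fundamentalDomain b := by
    rw [ZSpan.fundamentalDomain_pi_basisFun]
    exact (Measure.univ_pi_Ico_ae_eq_Icc (f := 0) (g := 1)).symm
  have hT (x : (Fin d ⊕ Fin d) → ℝ) :
      T0 f x = ∑' g : Submodule.span ℤ (Set.range b), f (g +ᵥ x) := by
    simp_rw [T0, ← he]
    exact (e.toEquiv.tsum_eq fun r => f (x + fun i => (r i : ℝ))).symm
  have hcount : Countable (Submodule.span ℤ (Set.range b)) := e.toEquiv.countable_iff.2 inferInstance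
  have hmeas (g : Submodule.span ℤ (Set.range b)) :
      AEStronglyMeasurable (fun x => f (g +ᵥ x)) volume :=
    (hf.comp_add_left (g : (Fin d ⊕ Fin d) → ℝ)).aestronglyMeasurable
  rw [setIntegral_congr_set hset, hdom.integral_eq_tsum'' f hf]
  simp_rw [hT]
  refine integral_tsum (fun g => (hmeas g).restrict) ?_
  rw [← hdom.lintegral_eq_tsum'' fun x => ‖f x‖ₑ]
  exact hf.2.ne

theorem integral_comp_Jmat_transpose {d : ℕ} (f : ((Fin d ⊕ Fin d) → ℝ) → ℂ) :
    ∫ w, f ((Jmat d)ᵀ.mulVec w) = ∫ w, f w := by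
  have hdet : (Jmat d)ᵀ.det * (Jmat d)ᵀ.det = 1 := by
    rw [det_transpose]; exact Matrix.J_det_mul_J_det (Fin d) ℝ
  have h0 : (Jmat d)ᵀ.det ≠ 0 := left_ne_zero_of_mul_eq_one hdet
  have habs : |(Jmat d)ᵀ.det⁻¹| = 1 := by
    rcases mul_self_eq_one_iff.1 hdet with h | h <;> simp [h]
  have hmap := Real.map_matrix_volume_pi_eq_smul_volume_pi h0
  rw [habs, ENNReal.ofReal_one, one_smul] at hmap
  have hemb : MeasurableEmbedding (Matrix.toLin' (Jmat d)ᵀ) :=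
    (LinearMap.continuous_of_finiteDimensional _).measurableEmbedding
      (Matrix.mulVec_injective_of_isUnit ((Matrix.isUnit_iff_isUnit_det _).2 h0.isUnit))
  exact MeasurePreserving.integral_comp ⟨hemb.measurable, hmap⟩ hemb f

theorem Jmat_mul_transpose (d : ℕ) : Jmat d * (Jmat d)ᵀ = 1 := by
  change Matrix.J (Fin d) ℝ * (Matrix.J (Fin d) ℝ)ᵀ = 1
  rw [Matrix.J_transpose, mul_neg, Matrix.J_squared, neg_neg]

theorem ip_mulVec {d : ℕ} (A : Matrix (Fin d ⊕ Fin d) (Fin d ⊕ Fin d) ℝ)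
    (v w : (Fin d ⊕ Fin d) → ℝ) : ip v (A.mulVec w) = ip (Aᵀ.mulVec v) w := by
  change v ⬝ᵥ A.mulVec w = Aᵀ.mulVec v ⬝ᵥ w
  rw [Matrix.dotProduct_mulVec, Matrix.mulVec_transpose]

theorem ip_comm {d : ℕ} (v w : (Fin d ⊕ Fin d) → ℝ) : ip v w = ip w v :=
  dotProduct_comm v w

theorem ip_add_right {d : ℕ} (u v w : (Fin d ⊕ Fin d) → ℝ) : ip u (v + w) = ip u v + ip u w :=
  dotProduct_add u v w

theorem ip_sub_left {d : ℕ} (u v w : (Fin d ⊕ Fin d) → ℝ) : ip (u - v) w = ip u w - ip v w :=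
  sub_dotProduct u v w

theorem ip_neg_left {d : ℕ} (u v : (Fin d ⊕ Fin d) → ℝ) : ip (-u) v = -ip u v :=
  neg_dotProduct u v

theorem ip_smul_left {d : ℕ} (c : ℝ) (u v : (Fin d ⊕ Fin d) → ℝ) : ip (c • u) v = c * ip u v :=
  smul_dotProduct c u v

theorem ip_smul_right {d : ℕ} (c : ℝ) (u v : (Fin d ⊕ Fin d) → ℝ) : ip u (c • v) = c * ip u v :=
  dotProduct_smul c u v

theorem ip_Jmat_self {d : ℕ} (u : (Fin d ⊕ Fin d) → ℝ) : ip u ((Jmat d).mulVec u) = 0 := by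
  have h := ip_mulVec (Jmat d) u u
  have hJ : (Jmat d)ᵀ = -Jmat d := Matrix.J_transpose (Fin d) ℝ
  rw [hJ, Matrix.neg_mulVec, ip_neg_left, ip_comm ((Jmat d).mulVec u)] at h
  linarith

theorem ip_Jmat_Jmat {d : ℕ} (u v : (Fin d ⊕ Fin d) → ℝ) :
    ip ((Jmat d).mulVec u) ((Jmat d).mulVec v) = ip u v := by
  rw [ip_comm, ip_mulVec, Matrix.mulVec_mulVec, mul_eq_one_comm.1 (Jmat_mul_transpose d),
    Matrix.one_mulVec, ip_comm]

@[fun_prop]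
theorem continuous_ip {d : ℕ} {X : Type*} [TopologicalSpace X]
    {f g : X → (Fin d ⊕ Fin d) → ℝ} (hf : Continuous f) (hg : Continuous g) :
    Continuous fun x => ip (f x) (g x) := by
  unfold ip
  fun_prop

/-- The Moyal product as a twisted convolution against the Fourier transform of its second
factor. -/
theorem moyal_eq_integral_FT {d N : ℕ} (hN : 1 ≤ N) (f g : ((Fin d ⊕ Fin d) → ℝ) → ℂ)
    (w : (Fin d ⊕ Fin d) → ℝ) :
    moyal d (1 / (2 * Real.pi * N)) f g w =
      ∫ u, f (w - (2 * N : ℝ)⁻¹ • (Jmat d).mulVec u) * FT g (-u) *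
        Complex.exp (-(2 * Real.pi * Complex.I) * (ip u w : ℝ)) := by
  have hN0 : (N : ℝ) ≠ 0 := by positivity
  let h : ((Fin d ⊕ Fin d) → ℝ) → ℂ := fun v =>
    f (w + (2 * N : ℝ)⁻¹ • (Jmat d).mulVec v) * FT g v *
      Complex.exp ((2 * Real.pi * Complex.I) * (ip v w : ℝ))
  have hinner (w₁ : (Fin d ⊕ Fin d) → ℝ) :
      (∫ w₂ : (Fin d ⊕ Fin d) → ℝ, f (w + w₁) * g (w + w₂) *
        Complex.exp (-(2 * Complex.I / ((1 / (2 * Real.pi * N) : ℝ) : ℂ)) *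
          (ip w₁ ((Jmat d).mulVec w₂) : ℝ))) =
      h ((2 * N : ℝ) • (Jmat d)ᵀ.mulVec w₁) := by
    have harg : (2 * N : ℝ)⁻¹ • (Jmat d).mulVec ((2 * N : ℝ) • (Jmat d)ᵀ.mulVec w₁) = w₁ := by
      rw [Matrix.mulVec_smul, Matrix.mulVec_mulVec, Jmat_mul_transpose, Matrix.one_mulVec,
        inv_smul_smul₀ (by positivity)]
    simp only [h, harg]
    rw [FT, ← integral_add_left_eq_self (fun v => g v *
      Complex.exp (-(2 * Real.pi * Complex.I) *
        (ip ((2 * N : ℝ) • (Jmat d)ᵀ.mulVec w₁) v : ℝ))) w, ← integral_const_mul,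
      ← integral_mul_const]
    refine integral_congr_ae (.of_forall fun w₂ => ?_)
    have hexp : Complex.exp (-(2 * Complex.I / ((1 / (2 * Real.pi * N) : ℝ) : ℂ)) *
          (ip w₁ ((Jmat d).mulVec w₂) : ℝ)) =
        Complex.exp (-(2 * Real.pi * Complex.I) *
          (ip ((2 * N : ℝ) • (Jmat d)ᵀ.mulVec w₁) (w + w₂) : ℝ)) *
        Complex.exp ((2 * Real.pi * Complex.I) *
          (ip ((2 * N : ℝ) • (Jmat d)ᵀ.mulVec w₁) w : ℝ)) := by
      rw [← Complex.exp_add, ip_mulVec, ip_add_right, ip_smul_left, ip_smul_left]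
      congr 1
      push_cast
      field_simp
      ring
    linear_combination (f (w + w₁) * g (w + w₂)) * hexp
  rw [moyal]
  simp_rw [hinner]
  rw [integral_comp_Jmat_transpose fun v => h ((2 * N : ℝ) • v),
    Measure.integral_comp_smul volume h, ← integral_neg_eq_self h,
    Module.finrank_fintype_fun_eq_card, Fintype.card_sum, Fintype.card_fin, ← two_mul,
    Complex.real_smul, ← mul_assoc, ← Complex.ofReal_mul,
    abs_of_pos (by positivity)]
  have hc : ((Real.pi * (1 / (2 * Real.pi * N))) ^ (2 * d))⁻¹ * ((2 * N : ℝ) ^ (2 * d))⁻¹ = 1 := by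
    rw [← mul_inv, ← mul_pow]
    have : Real.pi * (1 / (2 * Real.pi * N)) * (2 * N) = 1 := by field_simp
    rw [this, one_pow, inv_one]
  rw [hc, Complex.ofReal_one, one_mul]
  refine integral_congr_ae (.of_forall fun u => ?_)
  simp only [h, ip_neg_left, Matrix.mulVec_neg, smul_neg, ← sub_eq_add_neg]
  congr 2
  push_cast
  ring

/-- The Fourier transform of a Schwartz function is continuous and integrable. -/
theorem continuous_integrable_FT {d : ℕ} (F : SchwartzMap ((Fin d ⊕ Fin d) → ℝ) ℂ) :
    Continuous (FT F) ∧ Integrable (FT F) := by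
  let e := EuclideanSpace.equiv (Fin d ⊕ Fin d) ℝ
  let G : SchwartzMap (EuclideanSpace ℝ (Fin d ⊕ Fin d)) ℂ :=
    SchwartzMap.compCLMOfContinuousLinearEquiv ℝ e F
  have hFT : FT F = fun ρ => FourierTransform.fourier G (e.symm ρ) := by
    ext ρ
    rw [SchwartzMap.fourier_coe, Real.fourier_eq', FT,
      ← (EuclideanSpace.volume_preserving_symm_measurableEquiv_toLp
        (Fin d ⊕ Fin d)).symm.integral_comp']
    refine integral_congr_ae (.of_forall fun w => ?_)
    have hw : inner ℝ ((MeasurableEquiv.toLp 2 ((Fin d ⊕ Fin d) → ℝ)) w) (e.symm ρ) = ip ρ w :=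
      rfl
    simp only [MeasurableEquiv.symm_symm, hw, smul_eq_mul]
    rw [mul_comm]
    congr 2
    push_cast
    ring
  rw [hFT]
  exact ⟨(FourierTransform.fourier G).continuous.comp e.symm.continuous,
    (PiLp.volume_preserving_toLp (Fin d ⊕ Fin d)).integrable_comp_of_integrable
      (FourierTransform.fourier G).integrable⟩

theorem integrable_moyal_kernel {d : ℕ} {f h : ((Fin d ⊕ Fin d) → ℝ) → ℂ} (c : ℝ)
    (m : (Fin d ⊕ Fin d) → ℝ) (hf : Continuous f) (hfi : Integrable f) (hh : Continuous h)
    (hhi : Integrable h) :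
    Integrable (Function.uncurry fun w u : (Fin d ⊕ Fin d) → ℝ =>
      Complex.exp ((2 * Real.pi * Complex.I) * (ip w m : ℝ)) *
        (f (w - c • (Jmat d).mulVec u) * h (-u) *
          Complex.exp (-(2 * Real.pi * Complex.I) * (ip u w : ℝ)))) (volume.prod volume) := by
  have hJ : Continuous fun u : (Fin d ⊕ Fin d) → ℝ => (Jmat d).mulVec u :=
    Continuous.matrix_mulVec continuous_const continuous_id
  have hnorm (w u : (Fin d ⊕ Fin d) → ℝ) :
      ‖Complex.exp ((2 * Real.pi * Complex.I) * (ip w m : ℝ)) *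
        (f (w - c • (Jmat d).mulVec u) * h (-u) *
          Complex.exp (-(2 * Real.pi * Complex.I) * (ip u w : ℝ)))‖ =
      ‖f (w - c • (Jmat d).mulVec u)‖ * ‖h (-u)‖ := by
    simp [Complex.norm_exp]
  have hcont : Continuous (Function.uncurry fun w u : (Fin d ⊕ Fin d) → ℝ =>
      Complex.exp ((2 * Real.pi * Complex.I) * (ip w m : ℝ)) *
        (f (w - c • (Jmat d).mulVec u) * h (-u) *
          Complex.exp (-(2 * Real.pi * Complex.I) * (ip u w : ℝ)))) := by
    unfold Function.uncurry
    fun_prop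
  rw [integrable_prod_iff' hcont.aestronglyMeasurable]
  simp only [Function.uncurry_apply_pair, hnorm]
  refine ⟨.of_forall fun u => ?_, ?_⟩
  · refine Integrable.mono' ((hfi.comp_sub_right (c • (Jmat d).mulVec u)).norm.mul_const ‖h (-u)‖)
      (hcont.comp (by fun_prop : Continuous fun w => (w, u))).aestronglyMeasurable
      (.of_forall fun w => ?_)
    exact (hnorm w u).le
  · simp_rw [integral_mul_const, integral_sub_right_eq_self fun w => ‖f w‖]
    exact hhi.comp_neg.norm.const_mul _

/-- The inner integral over the position variable in the Fourier coefficient. -/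
theorem integral_moyal_kernel {d N : ℕ} (hN : 1 ≤ N) (f : ((Fin d ⊕ Fin d) → ℝ) → ℂ) (z : ℂ)
    (n u : (Fin d ⊕ Fin d) → ℝ) :
    (∫ w, Complex.exp ((2 * Real.pi * Complex.I) * (ip w ((Jmat d).mulVec n) : ℝ)) *
        (f (w - (2 * N : ℝ)⁻¹ • (Jmat d).mulVec u) * z *
          Complex.exp (-(2 * Real.pi * Complex.I) * (ip u w : ℝ)))) =
      Complex.exp ((Complex.I * Real.pi / N) * (ip n u : ℝ)) *
        FT f (u - (Jmat d).mulVec n) * z := by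
  have hNC : (N : ℂ) ≠ 0 := by
    exact_mod_cast (show N ≠ 0 by lia)
  rw [← integral_add_right_eq_self _ ((2 * N : ℝ)⁻¹ • (Jmat d).mulVec u), FT,
    ← integral_const_mul, ← integral_mul_const]
  refine integral_congr_ae (.of_forall fun w => ?_)
  simp only [add_sub_cancel_right]
  have hexp : Complex.exp ((2 * Real.pi * Complex.I) *
        (ip (w + (2 * N : ℝ)⁻¹ • (Jmat d).mulVec u) ((Jmat d).mulVec n) : ℝ)) *
      Complex.exp (-(2 * Real.pi * Complex.I) *
        (ip u (w + (2 * N : ℝ)⁻¹ • (Jmat d).mulVec u) : ℝ)) =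
      Complex.exp ((Complex.I * Real.pi / N) * (ip n u : ℝ)) *
        Complex.exp (-(2 * Real.pi * Complex.I) * (ip (u - (Jmat d).mulVec n) w : ℝ)) := by
    rw [← Complex.exp_add, ← Complex.exp_add, ip_comm (w + _), ip_add_right, ip_add_right,
      ip_smul_right, ip_smul_right, ip_Jmat_self, ip_Jmat_Jmat, ip_sub_left]
    congr 1
    push_cast
    field_simp
    ring
  linear_combination (f w * z) * hexp

theorem T0_exp_mul {d : ℕ} (G : ((Fin d ⊕ Fin d) → ℝ) → ℂ) (n : (Fin d ⊕ Fin d) → ℤ)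
    (ρ : (Fin d ⊕ Fin d) → ℝ) :
    Complex.exp ((2 * Real.pi * Complex.I) *
        (ip ρ ((Jmat d).mulVec fun i => (n i : ℝ)) : ℝ)) * T0 G ρ =
      T0 (fun w => Complex.exp ((2 * Real.pi * Complex.I) *
        (ip w ((Jmat d).mulVec fun i => (n i : ℝ)) : ℝ)) * G w) ρ := by
  rw [T0, T0, ← tsum_mul_left]
  refine tsum_congr fun r => ?_
  obtain ⟨k, hk⟩ : ∃ k : ℤ,
      ip (fun i => (r i : ℝ)) ((Jmat d).mulVec fun i => (n i : ℝ)) = k := by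
    refine ⟨r ⬝ᵥ (Matrix.J (Fin d) ℤ).mulVec n, ?_⟩
    have hJ : Jmat d = (Matrix.J (Fin d) ℤ).map (Int.castRingHom ℝ) :=
      (Matrix.map_J (Fin d) (Int.castRingHom ℝ)).symm
    have h := RingHom.map_dotProduct (Int.castRingHom ℝ) r ((Matrix.J (Fin d) ℤ).mulVec n)
    rw [show Int.castRingHom ℝ ∘ (Matrix.J (Fin d) ℤ).mulVec n =
      (Jmat d).mulVec fun i => (n i : ℝ) from hJ ▸ funext (RingHom.map_mulVec _ _ _)] at h
    exact h.symm
  have hadd : ip (ρ + fun i => (r i : ℝ)) ((Jmat d).mulVec fun i => (n i : ℝ)) =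
      ip ρ ((Jmat d).mulVec fun i => (n i : ℝ)) + k := by
    rw [ip_comm, ip_add_right, ip_comm, ip_comm _ (fun i => (r i : ℝ)), hk]
  rw [hadd, Complex.ofReal_add, mul_add, Complex.exp_add]
  have : (2 * Real.pi * Complex.I) * ((k : ℝ) : ℂ) = k * (2 * Real.pi * Complex.I) := by
    push_cast; ring
  rw [this, Complex.exp_int_mul_two_pi_mul_I, mul_one]

/-- The Fourier coefficients of the periodized Moyal product of `f` and `g`, when `f` and the Fourier
transform of `g` are continuous and integrable. -/
theorem setIntegral_exp_mul_T0_moyal {d N : ℕ} (hN : 1 ≤ N) {f g : ((Fin d ⊕ Fin d) → ℝ) → ℂ}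
    (hf : Continuous f) (hfi : Integrable f) (hg : Continuous (FT g)) (hgi : Integrable (FT g))
    (n : (Fin d ⊕ Fin d) → ℤ) :
    (∫ ρ in Set.Icc (0 : (Fin d ⊕ Fin d) → ℝ) 1,
        Complex.exp ((2 * Real.pi * Complex.I) *
            (ip ρ ((Jmat d).mulVec fun i => (n i : ℝ)) : ℝ)) *
          T0 (moyal d (1 / (2 * Real.pi * N)) f g) ρ)
      = ∫ ρ : (Fin d ⊕ Fin d) → ℝ,
          Complex.exp ((Complex.I * Real.pi / N) * (ip (fun i => (n i : ℝ)) ρ : ℝ)) *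
            FT f (ρ - (Jmat d).mulVec fun i => (n i : ℝ)) * FT g (-ρ) := by
  have hK := integrable_moyal_kernel (2 * N : ℝ)⁻¹ ((Jmat d).mulVec fun i => (n i : ℝ))
    hf hfi hg hgi
  simp_rw [T0_exp_mul, moyal_eq_integral_FT hN, ← integral_const_mul]
  refine (setIntegral_Icc_T0 hK.integral_prod_left).trans ((integral_integral_swap hK).trans ?_)
  exact integral_congr_ae (.of_forall fun u => integral_moyal_kernel hN _ _ _ u)

/-- **Fourier coefficients of the periodized Moyal product.**
With `ℏ = 1/(2πN)`, for every `n ∈ ℤ^{2d}`,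
`∫_{[0,1]^{2d}} e^{2iπ⟨ρ,Jn⟩} T₀(conj F₁ ♯ F₂)(ρ) dρ
   = ∫_{ℝ^{2d}} e^{(iπ/N)⟨n,ρ⟩} (conj F₁)^(ρ − Jn) F̂₂(−ρ) dρ`. -/
theorem fourier_coefficient_periodized_moyal
    (d : ℕ) (N : ℕ) (hN : 1 ≤ N)
    (F₁ F₂ : SchwartzMap ((Fin d ⊕ Fin d) → ℝ) ℂ) (n : (Fin d ⊕ Fin d) → ℤ) :
    (∫ ρ in Set.Icc (0 : (Fin d ⊕ Fin d) → ℝ) 1,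
        Complex.exp ((2 * Real.pi * Complex.I) *
            (ip ρ ((Jmat d).mulVec fun i => (n i : ℝ)) : ℝ)) *
          T0 (moyal d (1 / (2 * Real.pi * N)) (fun w => conj (F₁ w)) (fun w => F₂ w)) ρ)
      = ∫ ρ : (Fin d ⊕ Fin d) → ℝ,
          Complex.exp ((Complex.I * Real.pi / N) * (ip (fun i => (n i : ℝ)) ρ : ℝ)) *
            FT (fun w => conj (F₁ w)) (ρ - (Jmat d).mulVec fun i => (n i : ℝ)) *
            FT (fun w => F₂ w) (-ρ) := by
  have hF : Continuous (fun w => conj (F₁ w)) := Complex.continuous_conj.comp F₁.continuous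
  have hFi : Integrable (fun w => conj (F₁ w)) :=
    F₁.integrable.norm.mono' hF.aestronglyMeasurable (.of_forall fun w => (RCLike.norm_conj _).le)
  obtain ⟨hG, hGi⟩ := continuous_integrable_FT F₂
  exact setIntegral_exp_mul_T0_moyal hN hF hFi hG hGi n

end
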